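/- arXiv:1209.5652 — 3 statements merged into one kernel-verified Lean document; each statement's English description precedes it below -/
import Mathlib

section
/- Let (a_n) be a sequence of complex numbers whose Dirichlet series f(s) = Σ_{n=1}^∞ a_n n^{-s} converges absolutely for Re(s) > σ, and let c > σ be a positive real constant. Then for every complex number x, the series x · Σ_{n=1}^∞ (a_n / n^c) · exp(-x / n^c) converges absolutely, and its sum equals R_c(x). -/
open Complex

theorem norm_exp_neg_mul_le {x z : ℂ} (hz : ‖z‖ ≤ 1) :
    ‖Complex.exp (-x * z)‖ ≤ Real.exp ‖x‖ := by
  refine (Complex.norm_exp_le_exp_norm _).trans (Real.exp_le_exp.mpr ?_)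
  rw [norm_mul, norm_neg]
  exact mul_le_of_le_one_right (norm_nonneg x) hz

theorem summable_norm_mul_exp_neg_mul {ι : Type*} {b d : ι → ℂ}
    (hb : Summable fun n => ‖b n‖) (hd : ∀ n, ‖d n‖ ≤ 1) (x : ℂ) :
    Summable fun n => ‖b n * Complex.exp (-x * d n)‖ := by
  refine Summable.of_nonneg_of_le (fun _ => norm_nonneg _) (fun n => ?_)
    (hb.mul_right (Real.exp ‖x‖))
  rw [norm_mul]
  exact mul_le_mul_of_nonneg_left (norm_exp_neg_mul_le (hd n)) (norm_nonneg _)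

theorem tsum_mul_exp_neg_mul {ι : Type*} {b d : ι → ℂ}
    (hb : Summable fun n => ‖b n‖) (hd : ∀ n, ‖d n‖ ≤ 1) (x : ℂ) :
    ∑' n, b n * Complex.exp (-x * d n) =
      ∑' k : ℕ, (-x) ^ k / (Nat.factorial k : ℂ) * ∑' n, b n * d n ^ k := by
  have hF : Summable (Function.uncurry fun (n : ι) (k : ℕ) =>
      b n * ((-x * d n) ^ k / (Nat.factorial k : ℂ))) := by
    have hprod := hb.mul_of_nonneg (Real.summable_pow_div_factorial ‖x‖)
      (fun _ => norm_nonneg _) (fun _ => by positivity)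
    refine Summable.of_norm_bounded hprod fun ⟨n, k⟩ => ?_
    simp only [Function.uncurry, norm_mul, norm_div, norm_pow, norm_neg, Complex.norm_natCast]
    gcongr
    exact mul_le_of_le_one_right (norm_nonneg x) (hd n)
  calc
    _ = ∑' n, ∑' k : ℕ, b n * ((-x * d n) ^ k / (Nat.factorial k : ℂ)) := by
      refine tsum_congr fun n => ?_
      rw [tsum_mul_left, Complex.exp_eq_exp_ℂ, NormedSpace.exp_eq_tsum_div]
    _ = ∑' k : ℕ, ∑' n, b n * ((-x * d n) ^ k / (Nat.factorial k : ℂ)) := hF.tsum_comm.symm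
    _ = _ := by
      refine tsum_congr fun k => ?_
      rw [← tsum_mul_left]
      refine tsum_congr fun n => ?_
      rw [mul_pow]
      ring

theorem natCast_succ_cpow_ofReal (n : ℕ) (r : ℝ) :
    ((n + 1 : ℕ) : ℂ) ^ (r : ℂ) = ((((n : ℝ) + 1) ^ r : ℝ) : ℂ) := by
  rw [Complex.ofReal_cpow (by positivity)]
  push_cast
  rfl

theorem norm_inv_ofReal_succ_rpow_le_one (n : ℕ) {c : ℝ} (hc : 0 ≤ c) :
    ‖(((((n : ℝ) + 1) ^ c : ℝ) : ℂ))⁻¹‖ ≤ 1 := by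
  have h : 1 ≤ ((n : ℝ) + 1) ^ c := Real.one_le_rpow (by simp) hc
  rw [norm_inv, Complex.norm_real, Real.norm_of_nonneg (by positivity)]
  exact inv_le_one_of_one_le₀ h

/-- Let `(aₙ)` be a sequence of complex numbers whose Dirichlet series
`f(s) = Σ_{n≥1} aₙ n^{-s}` converges absolutely for `Re(s) > σ`, and let `c > σ` be a positive
real constant.  Then for every complex `x`, the series `x · Σ_{n≥1} (aₙ/n^c) exp(-x/n^c)`
converges absolutely and its sum equals
`R_c(x) = Σ_{k≥1} (-1)^{k+1} f(ck) x^k / (k-1)!` (here written with index shifted by one). -/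
theorem riesz_general_exp_series
    (a : ℕ → ℂ) (σ : ℝ)
    (hconv : ∀ s : ℂ, σ < s.re →
      Summable fun n : ℕ => ‖a (n + 1) / ((n + 1 : ℕ) : ℂ) ^ s‖)
    (f : ℂ → ℂ)
    (hf : ∀ s : ℂ, σ < s.re → f s = ∑' n : ℕ, a (n + 1) / ((n + 1 : ℕ) : ℂ) ^ s)
    (c : ℝ) (hc0 : 0 < c) (hcσ : σ < c) (x : ℂ) :
    (Summable fun n : ℕ =>
      ‖a (n + 1) / ((((n : ℝ) + 1) ^ c : ℝ) : ℂ) *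
        Complex.exp (-x / ((((n : ℝ) + 1) ^ c : ℝ) : ℂ))‖) ∧
    x * ∑' n : ℕ, a (n + 1) / ((((n : ℝ) + 1) ^ c : ℝ) : ℂ) *
        Complex.exp (-x / ((((n : ℝ) + 1) ^ c : ℝ) : ℂ)) =
      ∑' k : ℕ,
        (-1 : ℂ) ^ k * f ((c * (k + 1) : ℝ) : ℂ) * x ^ (k + 1) / (Nat.factorial k : ℂ) := by
  have hb : Summable fun n : ℕ => ‖a (n + 1) / ((((n : ℝ) + 1) ^ c : ℝ) : ℂ)‖ := by
    simpa only [natCast_succ_cpow_ofReal] using hconv (c : ℂ) (by simpa using hcσ)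
  have hd (n : ℕ) := norm_inv_ofReal_succ_rpow_le_one n hc0.le
  have hf' (k : ℕ) : f ((c * (k + 1) : ℝ) : ℂ) =
      ∑' n : ℕ, a (n + 1) / ((((n : ℝ) + 1) ^ c : ℝ) : ℂ) *
        (((((n : ℝ) + 1) ^ c : ℝ) : ℂ))⁻¹ ^ k := by
    have hk : c ≤ c * (k + 1) := le_mul_of_one_le_right hc0.le (by simp)
    rw [hf _ (by rw [Complex.ofReal_re]; exact hcσ.trans_le hk)]
    refine tsum_congr fun n => ?_
    have hpow : ((n : ℝ) + 1) ^ (c * (k + 1)) = (((n : ℝ) + 1) ^ c) ^ (k + 1) := by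
      rw [Real.rpow_mul (by positivity), ← Real.rpow_natCast]
      push_cast
      rfl
    rw [natCast_succ_cpow_ofReal, hpow, Complex.ofReal_pow, pow_succ', inv_pow, div_eq_mul_inv,
      div_eq_mul_inv, mul_inv, mul_assoc]
  simp only [div_eq_mul_inv (-x)]
  refine ⟨summable_norm_mul_exp_neg_mul hb hd x, ?_⟩
  rw [tsum_mul_exp_neg_mul hb hd x, ← tsum_mul_left]
  refine tsum_congr fun k => ?_
  rw [← hf', neg_pow x k]
  ring
end

section
/- Let (a_n) be a sequence of complex numbers whose Dirichlet series f(s) = Σ_{n=1}^∞ a_n n^{-s} converges absolutely for Re(s) > σ, let c > σ be a positive real constant, and let m be a positive integer. Then for every complex number x, R_c(x) = Σ_{k=1}^{m} (-1)^{k+1} f(ck) x^k / (k-1)! + x · Σ_{n=1}^∞ (a_n / n^c) · F_m(-x / n^c), where the infinite series converges absolutely. -/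
open Complex

/-- `F m` is the `m`-th order remainder of the exponential series:
`F_m(x) = exp(x) − Σ_{k=0}^{m-1} x^k / k!`. -/
noncomputable def expRemainder (m : ℕ) (x : ℂ) : ℂ :=
  Complex.exp x - ∑ k ∈ Finset.range m, x ^ k / (Nat.factorial k : ℂ)

theorem hasSum_expRemainder (m : ℕ) (y : ℂ) :
    HasSum (fun k : ℕ => y ^ (k + m) / (Nat.factorial (k + m) : ℂ)) (expRemainder m y) := by
  have h : HasSum (fun k : ℕ => y ^ k / (Nat.factorial k : ℂ)) (Complex.exp y) := by
    rw [Complex.exp_eq_exp_ℂ]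
    exact NormedSpace.expSeries_div_hasSum_exp y
  exact (hasSum_nat_add_iff' m).2 h

theorem summable_mul_pow_div_factorial {b y : ℕ → ℂ} {r : ℝ} (hb : Summable fun n => ‖b n‖)
    (hy : ∀ n, ‖y n‖ ≤ r) :
    Summable fun p : ℕ × ℕ => b p.1 * (y p.1 ^ p.2 / (Nat.factorial p.2 : ℂ)) := by
  have hr : 0 ≤ r := (norm_nonneg _).trans (hy 0)
  refine Summable.of_norm_bounded (hb.mul_of_nonneg (Real.summable_pow_div_factorial r)
    (fun n => norm_nonneg _) (fun k => by positivity)) fun p => ?_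
  rw [norm_mul, norm_div, norm_pow, Complex.norm_natCast]
  have := hy p.1
  gcongr

theorem summable_mul_pow_add_div_factorial {b y : ℕ → ℂ} {r : ℝ}
    (hb : Summable fun n => ‖b n‖) (hy : ∀ n, ‖y n‖ ≤ r) (m : ℕ) :
    Summable fun p : ℕ × ℕ =>
      b p.1 * (y p.1 ^ (p.2 + m) / (Nat.factorial (p.2 + m) : ℂ)) :=
  (summable_mul_pow_div_factorial hb hy).comp_injective
    (i := fun p : ℕ × ℕ => (p.1, p.2 + m)) fun p q h => by
      simpa [Prod.ext_iff] using h

theorem summable_norm_mul_expRemainder {b y : ℕ → ℂ} {r : ℝ}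
    (hb : Summable fun n => ‖b n‖) (hy : ∀ n, ‖y n‖ ≤ r) (m : ℕ) :
    Summable fun n => ‖b n * expRemainder m (y n)‖ := by
  have h := (summable_mul_pow_add_div_factorial hb hy m).prod
  simp only [tsum_mul_left, (hasSum_expRemainder m _).tsum_eq] at h
  exact h.norm

theorem tsum_mul_expRemainder {b y : ℕ → ℂ} {r : ℝ}
    (hb : Summable fun n => ‖b n‖) (hy : ∀ n, ‖y n‖ ≤ r) (m : ℕ) :
    ∑' n, b n * expRemainder m (y n) =
      ∑' k : ℕ, ∑' n, b n * (y n ^ (k + m) / (Nat.factorial (k + m) : ℂ)) := by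
  have h : Summable (Function.uncurry fun n k : ℕ =>
      b n * (y n ^ (k + m) / (Nat.factorial (k + m) : ℂ))) :=
    summable_mul_pow_add_div_factorial hb hy m
  rw [h.tsum_comm]
  exact tsum_congr fun n => by rw [tsum_mul_left, (hasSum_expRemainder m _).tsum_eq]

theorem natCast_succ_cpow_mul_succ (n k : ℕ) (c : ℝ) :
    ((n + 1 : ℕ) : ℂ) ^ ((c * (k + 1) : ℝ) : ℂ) =
      ((((n : ℝ) + 1) ^ c : ℝ) : ℂ) ^ (k + 1) := by
  have h : (0 : ℝ) ≤ (n : ℝ) + 1 := by positivity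
  have h2 : ((n + 1 : ℕ) : ℂ) = (((n : ℝ) + 1 : ℝ) : ℂ) := by push_cast; rfl
  rw [h2, ← Complex.ofReal_cpow h, Real.rpow_mul h]
  norm_cast

/-- Under the standing hypotheses on the Dirichlet series `f` and `c > σ`,
for every positive integer `m` and every complex `x`,
`R_c(x) = Σ_{k=1}^{m} (-1)^{k+1} f(ck) x^k/(k-1)! + x · Σ_{n≥1} (aₙ/n^c) F_m(-x/n^c)`,
the infinite series converging absolutely.  (Sums over `k = 1, …` are reindexed by
`k ↦ k + 1`.) -/
theorem riesz_general_accelerated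
    (a : ℕ → ℂ) (σ : ℝ)
    (hconv : ∀ s : ℂ, σ < s.re →
      Summable fun n : ℕ => ‖a (n + 1) / ((n + 1 : ℕ) : ℂ) ^ s‖)
    (f : ℂ → ℂ)
    (hf : ∀ s : ℂ, σ < s.re → f s = ∑' n : ℕ, a (n + 1) / ((n + 1 : ℕ) : ℂ) ^ s)
    (c : ℝ) (hc0 : 0 < c) (hcσ : σ < c) (m : ℕ) (hm : 0 < m) (x : ℂ) :
    (Summable fun n : ℕ =>
      ‖a (n + 1) / ((((n : ℝ) + 1) ^ c : ℝ) : ℂ) *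
        expRemainder m (-x / ((((n : ℝ) + 1) ^ c : ℝ) : ℂ))‖) ∧
    (∑' k : ℕ,
        (-1 : ℂ) ^ k * f ((c * (k + 1) : ℝ) : ℂ) * x ^ (k + 1) / (Nat.factorial k : ℂ)) =
      (∑ k ∈ Finset.range m,
        (-1 : ℂ) ^ k * f ((c * (k + 1) : ℝ) : ℂ) * x ^ (k + 1) / (Nat.factorial k : ℂ)) +
      x * ∑' n : ℕ, a (n + 1) / ((((n : ℝ) + 1) ^ c : ℝ) : ℂ) *
        expRemainder m (-x / ((((n : ℝ) + 1) ^ c : ℝ) : ℂ)) := by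
  have hq : ∀ n : ℕ, 1 ≤ ((n : ℝ) + 1) ^ c := fun n =>
    Real.one_le_rpow (by simp) hc0.le
  have hσ : ∀ k : ℕ, σ < ((c * (k + 1) : ℝ) : ℂ).re := fun k => by
    rw [Complex.ofReal_re]
    have : (0 : ℝ) ≤ c * k := by positivity
    linarith
  have hb : Summable fun n : ℕ => ‖a (n + 1) / ((((n : ℝ) + 1) ^ c : ℝ) : ℂ)‖ := by
    have h := hconv _ (hσ 0)
    simpa only [natCast_succ_cpow_mul_succ, zero_add, pow_one] using h
  have hy : ∀ n : ℕ, ‖-x / ((((n : ℝ) + 1) ^ c : ℝ) : ℂ)‖ ≤ ‖x‖ := fun n => by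
    rw [norm_div, norm_neg, Complex.norm_real, Real.norm_of_nonneg (zero_le_one.trans (hq n))]
    exact div_le_self (norm_nonneg _) (hq n)
  have hterm : ∀ k : ℕ,
      (-1 : ℂ) ^ k * f ((c * (k + 1) : ℝ) : ℂ) * x ^ (k + 1) / (Nat.factorial k : ℂ) =
        x * ∑' n : ℕ, a (n + 1) / ((((n : ℝ) + 1) ^ c : ℝ) : ℂ) *
          ((-x / ((((n : ℝ) + 1) ^ c : ℝ) : ℂ)) ^ k / (Nat.factorial k : ℂ)) := fun k => by
    rw [hf _ (hσ k), ← tsum_mul_left, ← tsum_mul_left, ← tsum_mul_right, ← tsum_div_const]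
    refine tsum_congr fun n => ?_
    rw [natCast_succ_cpow_mul_succ, div_pow, neg_pow x]
    have hne : ((((n : ℝ) + 1) ^ c : ℝ) : ℂ) ≠ 0 :=
      Complex.ofReal_ne_zero.2 (zero_lt_one.trans_le (hq n)).ne'
    field_simp
    ring
  refine ⟨summable_norm_mul_expRemainder hb hy m, ?_⟩
  simp only [hterm]
  rw [tsum_mul_expRemainder hb hy m, ← tsum_mul_left]
  exact (Summable.sum_add_tsum_nat_add m
    ((summable_mul_pow_div_factorial hb hy).prod_symm.prod.mul_left x)).symm
end

section
/- Let c > 1 be a real constant and let Riesz_c be the entire function defined by Riesz_c(x) = Σ_{k=1}^∞ (-1)^{k+1} x^k / ((k-1)! ζ(ck)). Then the Riemann hypothesis holds if and only if for every ε > 0, Riesz_c(x) = O(x^{1/(2c) + ε}) as x → ∞ along the positive reals. -/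
open Complex Filter Asymptotics

section Riesz

open MeasureTheory Set

/-- The Mellin transform `∫_1^∞ {t} t^{-s-1} dt`. -/
noncomputable def fractMellin (s : ℂ) : ℂ :=
  mellin ((Ioi (1 : ℝ)).indicator fun t => ((Int.fract t : ℝ) : ℂ)) (-s)

/-- The function `(s - 1) ζ(s)` on the half-plane `0 < re s`, with its removable singularity at
`s = 1` removed. -/
noncomputable def zetaMulSubOne (s : ℂ) : ℂ := s - s * (s - 1) * fractMellin s

lemma norm_indicator_fract_le (t : ℝ) :
    ‖(Ioi (1 : ℝ)).indicator (fun t => ((Int.fract t : ℝ) : ℂ)) t‖ ≤ 1 := by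
  refine (norm_indicator_le_norm_self _ _).trans ?_
  rw [Complex.norm_real, Real.norm_of_nonneg (Int.fract_nonneg t)]
  exact (Int.fract_lt_one t).le

lemma measurable_indicator_fract :
    Measurable ((Ioi (1 : ℝ)).indicator fun t => ((Int.fract t : ℝ) : ℂ)) := by
  refine Measurable.indicator ?_ measurableSet_Ioi
  exact Complex.measurable_ofReal.comp measurable_fract

lemma locallyIntegrableOn_indicator_fract :
    LocallyIntegrableOn ((Ioi (1 : ℝ)).indicator fun t => ((Int.fract t : ℝ) : ℂ)) (Ioi 0) := by
  refine LocallyIntegrable.locallyIntegrableOn ?_ _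
  refine (locallyIntegrable_const (1 : ℝ)).mono
    measurable_indicator_fract.aestronglyMeasurable ?_
  filter_upwards with t
  simpa using norm_indicator_fract_le t

lemma isBigO_atTop_indicator_fract :
    ((Ioi (1 : ℝ)).indicator fun t => ((Int.fract t : ℝ) : ℂ)) =O[atTop]
      fun t : ℝ => t ^ (-(0 : ℝ)) := by
  refine IsBigO.of_bound 1 ?_
  filter_upwards with t
  simpa using norm_indicator_fract_le t

lemma isBigO_nhds_zero_indicator_fract (b : ℝ) :
    ((Ioi (1 : ℝ)).indicator fun t => ((Int.fract t : ℝ) : ℂ)) =O[nhdsWithin 0 (Ioi 0)]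
      fun t : ℝ => t ^ (-b) := by
  refine IsBigO.of_bound 1 ?_
  have : ∀ᶠ t : ℝ in nhdsWithin 0 (Ioi 0), t < 1 :=
    nhdsWithin_le_nhds (eventually_lt_nhds one_pos)
  filter_upwards [this] with t ht
  rw [indicator_of_notMem (by simpa using ht.le)]
  simp

lemma differentiableAt_fractMellin {s : ℂ} (hs : 0 < s.re) :
    DifferentiableAt ℂ fractMellin s := by
  refine DifferentiableAt.comp (g := mellin _) s ?_ differentiableAt_id.neg
  exact mellin_differentiableAt_of_isBigO_rpow (a := 0) (b := -s.re - 1)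
    locallyIntegrableOn_indicator_fract isBigO_atTop_indicator_fract (by simpa using hs)
    (isBigO_nhds_zero_indicator_fract _) (by simp)

lemma mellinConvergent_indicator_fract {s : ℂ} (hs : 0 < s.re) :
    MellinConvergent ((Ioi (1 : ℝ)).indicator fun t => ((Int.fract t : ℝ) : ℂ)) (-s) :=
  mellinConvergent_of_isBigO_rpow (a := 0) (b := -s.re - 1)
    locallyIntegrableOn_indicator_fract isBigO_atTop_indicator_fract (by simpa using hs)
    (isBigO_nhds_zero_indicator_fract _) (by simp)

lemma fractMellin_eq_setIntegral (s : ℂ) :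
    fractMellin s = ∫ t in Ioi (1 : ℝ), ((Int.fract t : ℝ) : ℂ) * (t : ℂ) ^ (-s - 1) := by
  rw [fractMellin, mellin, ← integral_indicator measurableSet_Ioi,
    ← integral_indicator measurableSet_Ioi]
  congr 1
  ext t
  by_cases ht : 1 < t
  · simp [indicator, ht, one_pos.trans ht, mul_comm]
  · simp [indicator, ht]

lemma norm_fractMellin_le {s : ℂ} (hs : 0 < s.re) : ‖fractMellin s‖ ≤ 1 / s.re := by
  rw [fractMellin_eq_setIntegral]
  have h_rpow_int : IntegrableOn (fun t : ℝ => t ^ (-s.re - 1)) (Ioi 1) :=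
    integrableOn_Ioi_rpow_of_lt (by linarith) one_pos
  refine (norm_integral_le_of_norm_le h_rpow_int ?_).trans ?_
  · filter_upwards [ae_restrict_mem measurableSet_Ioi] with t ht
    have h0 : (0 : ℝ) < t := one_pos.trans ht
    rw [norm_mul, Complex.norm_real, Real.norm_of_nonneg (Int.fract_nonneg t),
      Complex.norm_cpow_eq_rpow_re_of_pos h0]
    simp only [sub_re, neg_re, one_re]
    exact mul_le_of_le_one_left (by positivity) (Int.fract_lt_one t).le
  · rw [integral_Ioi_rpow_of_lt (by linarith) one_pos]
    simp

lemma zetaMulSubOne_of_one_lt_re {s : ℂ} (hs : 1 < s.re) :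
    zetaMulSubOne s = (s - 1) * riemannZeta s := by
  have hs0 : 0 < s.re := one_pos.trans hs
  have hs1 : s - 1 ≠ 0 := by
    intro h
    rw [sub_eq_zero.mp h] at hs
    simp at hs
  have h1 : riemannZeta s =
      s * ∫ t in Ioi (1 : ℝ), ((⌊t⌋₊ : ℝ) : ℂ) * (t : ℂ) ^ (-(s + 1)) := by
    have := LSeries_eq_mul_integral_of_nonneg (fun _ => (1 : ℝ)) (r := 1) zero_le_one hs
      (by simpa using (isBigO_refl (fun n : ℕ => (n : ℝ)) atTop)) (by simp)
    rw [← LSeries_one_eq_riemannZeta hs]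
    convert this using 4
    · simp
    · simp
  have h2 : ∫ t in Ioi (1 : ℝ), (t : ℂ) ^ (-s) = 1 / (s - 1) := by
    rw [integral_Ioi_cpow_of_lt (by simpa using hs) one_pos]
    have : -s + 1 = -(s - 1) := by ring
    rw [this, ofReal_one, one_cpow, neg_div_neg_eq]
  have hf : IntegrableOn (fun t : ℝ => ((Int.fract t : ℝ) : ℂ) * (t : ℂ) ^ (-s - 1)) (Ioi 1) := by
    have := (mellinConvergent_indicator_fract hs0).mono_set
      (Ioi_subset_Ioi (zero_le_one (α := ℝ)))
    refine this.congr_fun (fun t ht => ?_) measurableSet_Ioi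
    simp only [indicator_of_mem ht, smul_eq_mul]
    ring
  have hg : IntegrableOn (fun t : ℝ => (t : ℂ) ^ (-s)) (Ioi 1) :=
    integrableOn_Ioi_cpow_of_lt (by simpa using hs) one_pos
  have h3 : ∫ t in Ioi (1 : ℝ), ((⌊t⌋₊ : ℝ) : ℂ) * (t : ℂ) ^ (-(s + 1)) =
      1 / (s - 1) - fractMellin s := by
    rw [fractMellin_eq_setIntegral, ← h2, ← integral_sub hg hf]
    refine setIntegral_congr_fun measurableSet_Ioi fun t ht => ?_
    have h0 : (0 : ℝ) < t := one_pos.trans ht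
    have h0' : (t : ℂ) ≠ 0 := by exact_mod_cast h0.ne'
    have e : (t : ℂ) ^ (-s) = t * (t : ℂ) ^ (-s - 1) := by
      rw [cpow_sub _ _ h0', cpow_one]
      field_simp
    rw [e, ← sub_mul, show -(s + 1) = -s - 1 by ring]
    congr 1
    rw [← Int.self_sub_floor, natCast_floor_eq_intCast_floor h0.le]
    push_cast
    ring
  rw [h1, h3, zetaMulSubOne]
  field_simp

lemma differentiableOn_zetaMulSubOne :
    DifferentiableOn ℂ zetaMulSubOne {s | 0 < s.re} := fun s hs => by
  have := differentiableAt_fractMellin hs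
  unfold zetaMulSubOne
  exact DifferentiableAt.differentiableWithinAt (by fun_prop)

@[simp] lemma zetaMulSubOne_one : zetaMulSubOne 1 = 1 := by simp [zetaMulSubOne]

lemma zetaMulSubOne_eq {s : ℂ} (hs : 0 < s.re) (hs1 : s ≠ 1) :
    zetaMulSubOne s = (s - 1) * riemannZeta s := by
  have hopen : IsOpen {s : ℂ | 0 < s.re} := isOpen_lt continuous_const continuous_re
  have hA : AnalyticOnNhd ℂ zetaMulSubOne {s | 0 < s.re} :=
    differentiableOn_zetaMulSubOne.analyticOnNhd hopen
  have hB : Differentiable ℂ (Function.update (fun s => (s - 1) * riemannZeta s) 1 1) := by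
    have hd : ∀ z : ℂ, z ≠ 1 → DifferentiableAt ℂ
        (Function.update (fun s => (s - 1) * riemannZeta s) 1 1) z := fun z hz => by
      have h : DifferentiableAt ℂ (fun s => (s - 1) * riemannZeta s) z :=
        (differentiableAt_id.sub_const 1).mul (differentiableAt_riemannZeta hz)
      refine h.congr_of_eventuallyEq ?_
      filter_upwards [isOpen_ne.mem_nhds hz] with w hw
      rw [Function.update_of_ne hw]
    intro z
    rcases eq_or_ne z 1 with rfl | hz
    · refine (analyticAt_of_differentiable_on_punctured_nhds_of_continuousAt ?_ ?_).differentiableAt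
      · filter_upwards [self_mem_nhdsWithin] with w hw using hd w hw
      · rw [continuousAt_update_same]
        exact riemannZeta_residue_one
    · exact hd z hz
  have heq := hA.eqOn_of_preconnected_of_eventuallyEq
    (hB.differentiableOn.analyticOnNhd hopen) (convex_halfSpace_re_gt 0).isPreconnected
    (z₀ := 2) (by simp) (by
      have h2 : {s : ℂ | 1 < s.re} ∈ nhds (2 : ℂ) :=
        (isOpen_lt continuous_const continuous_re).mem_nhds (by simp)
      filter_upwards [h2] with w hw
      have : w ≠ 1 := by
        rintro rfl
        simp at hw
      rw [zetaMulSubOne_of_one_lt_re hw, Function.update_of_ne this])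
  rw [heq hs, Function.update_of_ne hs1]

lemma riemannHypothesis_iff_zetaMulSubOne_ne_zero :
    RiemannHypothesis ↔ ∀ s : ℂ, 1 / 2 < s.re → zetaMulSubOne s ≠ 0 := by
  have key : ∀ s : ℂ, 1 / 2 < s.re → s ≠ 1 → zetaMulSubOne s = (s - 1) * riemannZeta s :=
    fun s hs hs1 => zetaMulSubOne_eq (by linarith) hs1
  constructor
  · intro h s hs h0
    rcases eq_or_ne s 1 with rfl | hs1
    · simp at h0
    rw [key s hs hs1, mul_eq_zero, or_iff_right (sub_ne_zero.mpr hs1)] at h0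
    have := h s h0 (by
      rintro ⟨n, rfl⟩
      simp at hs
      have : (0 : ℝ) ≤ n := n.cast_nonneg
      linarith) hs1
    linarith
  · intro h
    have hζ : ∀ s : ℂ, 1 / 2 < s.re → s ≠ 1 → riemannZeta s ≠ 0 := fun s hs hs1 h0 =>
      h s hs (by rw [key s hs hs1, h0, mul_zero])
    intro s h0 htriv hs1
    by_contra hre
    rcases lt_or_gt_of_ne hre with hlt | hgt
    · have hs0 : s ≠ 0 := by
        rintro rfl
        norm_num [riemannZeta_zero] at h0
      have hre' : 1 / 2 < (1 - s).re := by
        simp only [sub_re, one_re]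
        linarith
      have h1 : ∀ n : ℕ, 1 - s ≠ -n := fun n hn => by
        rw [hn] at hre'
        simp at hre'
        have : (0 : ℝ) ≤ n := n.cast_nonneg
        linarith
      have h2 : 1 - s ≠ 1 := by simpa using hs0
      have hfe := riemannZeta_one_sub h1 h2
      rw [sub_sub_cancel, h0] at hfe
      have hcos : Complex.cos (Real.pi * (1 - s) / 2) = 0 := by
        have hpi : (2 * (Real.pi : ℂ)) ^ (-(1 - s)) ≠ 0 := by
          rw [Ne, cpow_eq_zero_iff]
          simp [Real.pi_ne_zero]
        have hG := Complex.Gamma_ne_zero h1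
        have hz := hζ (1 - s) hre' h2
        simpa [hpi, hG, hz] using hfe.symm
      obtain ⟨k, hk⟩ := Complex.cos_eq_zero_iff.mp hcos
      have hpi : (Real.pi : ℂ) ≠ 0 := by exact_mod_cast Real.pi_ne_zero
      have hs : s = -2 * k := by
        have : (Real.pi : ℂ) * (1 - s) = Real.pi * (2 * k + 1) := by linear_combination 2 * hk
        linear_combination -(mul_left_cancel₀ hpi this)
      rw [hs] at hre'
      simp at hre'
      have hk0 : 0 ≤ k := by
        by_contra hneg
        have : (k : ℝ) ≤ -1 := by exact_mod_cast (show k ≤ -1 by omega)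
        linarith
      obtain ⟨n, rfl⟩ := Int.eq_ofNat_of_zero_le hk0
      rcases n with _ | n
      · simp at hs
        exact hs0 hs
      · exact htriv ⟨n, by rw [hs]; push_cast; ring⟩
    · exact hζ s hgt hs1 h0

lemma norm_zetaMulSubOne_le {s : ℂ} (hs : 1 / 2 ≤ s.re) :
    ‖zetaMulSubOne s‖ ≤ 3 * (1 + ‖s‖) ^ 2 := by
  have h1 : ‖fractMellin s‖ ≤ 2 := by
    refine (norm_fractMellin_le (by linarith)).trans ?_
    rw [div_le_iff₀ (by linarith)]
    linarith
  have h2 : ‖s - 1‖ ≤ ‖s‖ + 1 := by simpa using norm_sub_le s 1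
  have h0 := norm_nonneg s
  calc ‖zetaMulSubOne s‖ ≤ ‖s‖ + ‖s‖ * ‖s - 1‖ * ‖fractMellin s‖ := by
        simpa [zetaMulSubOne] using norm_sub_le s (s * (s - 1) * fractMellin s)
    _ ≤ ‖s‖ + ‖s‖ * (‖s‖ + 1) * 2 := by gcongr
    _ ≤ _ := by nlinarith

open scoped LSeries.notation ArithmeticFunction.Moebius in
lemma inv_riemannZeta_eq_tsum {s : ℂ} (hs : 1 < s.re) :
    HasSum (fun n : ℕ => ((ArithmeticFunction.moebius n : ℤ) : ℂ) * (n : ℂ) ^ (-s))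
      (riemannZeta s)⁻¹ := by
  have h1 := LSeries_one_mul_Lseries_moebius hs
  rw [LSeries_one_eq_riemannZeta hs] at h1
  have h2 := (ArithmeticFunction.LSeriesSummable_moebius_iff.mpr hs).LSeriesHasSum
  rw [← eq_inv_of_mul_eq_one_right h1]
  refine h2.congr_fun fun n => ?_
  rcases eq_or_ne n 0 with rfl | hn
  · simp
  · rw [LSeries.term_of_ne_zero hn, cpow_neg, div_eq_mul_inv]

lemma exists_norm_inv_zetaMulSubOne_two_add_le :
    ∃ B : ℝ, 1 ≤ B ∧ ∀ t : ℝ, ‖(zetaMulSubOne (2 + t * I))⁻¹‖ ≤ B := by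
  have hsum : Summable fun n : ℕ => (n : ℝ) ^ (-2 : ℝ) := Real.summable_nat_rpow.mpr (by norm_num)
  refine ⟨1 + ∑' n : ℕ, (n : ℝ) ^ (-2 : ℝ), ?_, fun t => ?_⟩
  · have : 0 ≤ ∑' n : ℕ, (n : ℝ) ^ (-2 : ℝ) := tsum_nonneg fun n => by positivity
    linarith
  have hre : 1 < (2 + t * I : ℂ).re := by simp
  have h1 : ‖(riemannZeta (2 + t * I))⁻¹‖ ≤ ∑' n : ℕ, (n : ℝ) ^ (-2 : ℝ) := by
    refine (inv_riemannZeta_eq_tsum hre).norm_le_of_bounded hsum.hasSum fun n => ?_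
    rcases Nat.eq_zero_or_pos n with rfl | hn
    · simp
    · rw [norm_mul, norm_natCast_cpow_of_pos hn]
      have h : ‖((ArithmeticFunction.moebius n : ℤ) : ℂ)‖ ≤ 1 := by
        rw [Complex.norm_intCast]
        exact_mod_cast ArithmeticFunction.abs_moebius_le_one
      simpa using mul_le_of_le_one_left (by positivity) h
  rw [zetaMulSubOne_of_one_lt_re hre, mul_inv, norm_mul, norm_inv]
  have h2 : 1 ≤ ‖(2 + t * I : ℂ) - 1‖ := by
    refine le_trans ?_ (re_le_norm _)
    simp
    norm_num
  calc _ ≤ 1 * ‖(riemannZeta (2 + t * I))⁻¹‖ := by gcongr; exact inv_le_one_of_one_le₀ h2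
    _ ≤ _ := by linarith

lemma exists_eq_mul_exp_of_ne_zero_on_ball {f : ℂ → ℂ} {R : ℝ} (hR : 0 < R)
    (hf : DifferentiableOn ℂ f (Metric.ball 0 R)) (h0 : ∀ z ∈ Metric.ball 0 R, f z ≠ 0) :
    ∃ L : ℂ → ℂ, DifferentiableOn ℂ L (Metric.ball 0 R) ∧ L 0 = 0 ∧
      ∀ z ∈ Metric.ball 0 R, f z = f 0 * exp (L z) := by
  have hmem : (0 : ℂ) ∈ Metric.ball 0 R := Metric.mem_ball_self hR
  have hd : DifferentiableOn ℂ (fun z => deriv f z / f z) (Metric.ball 0 R) :=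
    (hf.deriv Metric.isOpen_ball).div hf h0
  obtain ⟨L, hL0, hL⟩ := hd.isExactOn_ball.with_val_at 0 0
  refine ⟨L, fun z hz => (hL z hz).differentiableAt.differentiableWithinAt, hL0, fun z hz => ?_⟩
  have hder : ∀ w ∈ Metric.ball (0 : ℂ) R,
      HasDerivAt (fun w => f w * exp (-L w)) 0 w := fun w hw => by
    have h1 := (hf.differentiableAt (Metric.isOpen_ball.mem_nhds hw)).hasDerivAt
    have h2 := (hL w hw).neg.cexp
    refine (h1.mul h2).congr_deriv ?_
    linear_combination -exp (-L w) * mul_div_cancel₀ (deriv f w) (h0 w hw)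
  have hconst := Metric.isOpen_ball.is_const_of_deriv_eq_zero
    (Metric.isPreconnected_ball)
    (fun w hw => (hder w hw).differentiableAt.differentiableWithinAt)
    (fun w hw => (hder w hw).deriv) hz hmem
  simp only [hL0, neg_zero, exp_zero, mul_one] at hconst
  rw [← hconst, mul_assoc, ← exp_add]
  simp

lemma exists_norm_inv_zetaMulSubOne_le (h : ∀ s : ℂ, 1 / 2 < s.re → zetaMulSubOne s ≠ 0)
    {η : ℝ} (hη : 0 < η) : ∃ (C : ℝ) (N : ℕ), 0 < C ∧ ∀ s : ℂ, 1 / 2 + η ≤ s.re → s.re ≤ 2 →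
      ‖(zetaMulSubOne s)⁻¹‖ ≤ C * (2 + |s.im|) ^ N := by
  obtain ⟨B, hB1, hB⟩ := exists_norm_inv_zetaMulSubOne_two_add_le
  obtain ⟨N, hN⟩ := exists_nat_ge (3 / η)
  refine ⟨B * (B * 63) ^ N, 2 * N, by positivity, fun s hs1 hs2 => ?_⟩
  set t := s.im with ht
  set T := 2 + |t| with hT
  have hT2 : 2 ≤ T := by simp [hT]
  set f : ℂ → ℂ := fun z => zetaMulSubOne (2 + t * I + z) with hfdef
  have hre : ∀ z ∈ Metric.ball (0 : ℂ) (3 / 2), 1 / 2 < (2 + t * I + z).re := fun z hz => by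
    have := (abs_le.mp ((abs_re_le_norm z).trans (mem_ball_zero_iff.mp hz).le)).1
    have h3 := (abs_lt.mp ((abs_re_le_norm z).trans_lt (mem_ball_zero_iff.mp hz))).1
    simp
    linarith
  have hf : DifferentiableOn ℂ f (Metric.ball 0 (3 / 2)) :=
    differentiableOn_zetaMulSubOne.comp ((differentiable_const _).add differentiable_id).differentiableOn
      fun z hz => by
        have := hre z hz
        simp only [mem_ofPred_eq]
        linarith
  have hfne : ∀ z ∈ Metric.ball (0 : ℂ) (3 / 2), f z ≠ 0 := fun z hz => h _ (hre z hz)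
  obtain ⟨L, hLd, hL0, hL⟩ := exists_eq_mul_exp_of_ne_zero_on_ball (by norm_num) hf hfne
  have hf0 : f 0 = zetaMulSubOne (2 + t * I) := by simp [hfdef]
  have hf0ne : f 0 ≠ 0 := hfne 0 (Metric.mem_ball_self (by norm_num))
  have hBT : 1 < B * 63 * T ^ 2 := by nlinarith
  set M := Real.log (B * 63 * T ^ 2) with hM
  have hMpos : 0 < M := Real.log_pos hBT
  have hexpM : Real.exp M = B * 63 * T ^ 2 := Real.exp_log (by linarith)
  have hLre : MapsTo L (Metric.ball 0 (3 / 2)) {z | z.re ≤ M} := fun z hz => by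
    have hz' := (mem_ball_zero_iff.mp hz).le
    have h1 : ‖f z‖ ≤ 63 * T ^ 2 := by
      refine (norm_zetaMulSubOne_le (hre z hz).le).trans ?_
      have : ‖2 + t * I + z‖ ≤ 2 + |t| + 3 / 2 := by
        refine (norm_add_le _ _).trans (add_le_add ((norm_add_le _ _).trans ?_) hz')
        simp
      have h2 : 1 + ‖2 + t * I + z‖ ≤ 5 / 2 * T := by
        have := abs_nonneg t
        linarith
      calc 3 * (1 + ‖2 + t * I + z‖) ^ 2 ≤ 3 * (5 / 2 * T) ^ 2 := by gcongr
        _ ≤ _ := by nlinarith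
    have h2 : Real.exp (L z).re ≤ B * 63 * T ^ 2 := by
      have : exp (L z) = (f 0)⁻¹ * f z := by
        rw [hL z hz]
        field_simp
      rw [← norm_exp, this, norm_mul, mul_assoc]
      rw [hf0]
      gcongr
      exact hB t
    rw [← hexpM] at h2
    exact Real.exp_le_exp.mp h2
  set z : ℂ := ((s.re - 2 : ℝ) : ℂ) with hz
  have hzn : ‖z‖ ≤ 3 / 2 - η := by
    rw [hz, norm_real, Real.norm_eq_abs, abs_le]
    constructor <;> linarith
  have hzmem : z ∈ Metric.ball (0 : ℂ) (3 / 2) := mem_ball_zero_iff.mpr (by linarith)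
  have hsz : 2 + t * I + z = s := by
    apply Complex.ext <;> simp [hz, ht]
  have hLz : ‖L z‖ ≤ N * M := by
    refine (borelCaratheodory_zero hMpos hLd hLre (by norm_num) hzmem hL0).trans ?_
    have h1 : 2 * M * ‖z‖ / (3 / 2 - ‖z‖) ≤ 2 * M * (3 / 2) / η := by
      gcongr <;> linarith
    refine h1.trans ?_
    calc 2 * M * (3 / 2) / η = 3 / η * M := by ring
      _ ≤ N * M := by gcongr
  have hfz : zetaMulSubOne s = f 0 * exp (L z) := by
    rw [← hL z hzmem, hfdef]
    simp only [hsz]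
  rw [hfz, mul_inv, norm_mul, ← exp_neg, norm_exp]
  have h3 : Real.exp (-L z).re ≤ (B * 63 * T ^ 2) ^ N := by
    rw [← hexpM, ← Real.exp_nat_mul, Real.exp_le_exp]
    refine (re_le_norm _).trans ?_
    rwa [norm_neg]
  calc ‖(f 0)⁻¹‖ * Real.exp (-L z).re ≤ B * (B * 63 * T ^ 2) ^ N := by
        gcongr
        rw [hf0]
        exact hB t
    _ = _ := by rw [mul_pow, ← pow_mul, mul_assoc]

lemma exists_norm_Gamma_mul_le (N : ℕ) {a b : ℝ} (ha : 0 < a) :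
    ∃ C : ℝ, ∀ s : ℂ, a ≤ s.re → s.re ≤ b → ‖Gamma s‖ * (2 + |s.im|) ^ N ≤ C := by
  induction N generalizing a b with
  | zero =>
    have hc : ContinuousOn Real.Gamma (Icc a b) := fun x hx =>
      (Real.differentiableAt_Gamma fun m => by
        have := hx.1
        have : (0 : ℝ) ≤ m := m.cast_nonneg
        linarith).continuousAt.continuousWithinAt
    obtain ⟨C, hC⟩ := isCompact_Icc.exists_bound_of_continuousOn hc
    refine ⟨C, fun s hs1 hs2 => ?_⟩
    have hs0 : 0 < s.re := by linarith
    refine le_trans ?_ ((Real.le_norm_self _).trans (hC s.re ⟨hs1, hs2⟩))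
    rw [pow_zero, mul_one, Gamma_eq_integral hs0, Real.Gamma_eq_integral hs0, GammaIntegral]
    refine norm_integral_le_of_norm_le (Real.GammaIntegral_convergent hs0) ?_
    filter_upwards [ae_restrict_mem measurableSet_Ioi] with x hx
    rw [norm_mul, norm_cpow_eq_rpow_re_of_pos hx, norm_real, Real.norm_of_nonneg (Real.exp_nonneg _)]
    simp
  | succ N ih =>
    obtain ⟨C, hC⟩ := ih (a := a + 1) (b := b + 1) (by linarith)
    refine ⟨(2 + a) / a * C, fun s hs1 hs2 => ?_⟩
    have hs0 : 0 < s.re := by linarith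
    have h1 := hC (s + 1) (by simpa using hs1) (by simpa using hs2)
    have hne : s ≠ 0 := by
      rintro rfl
      simp at hs0
    rw [Gamma_add_one s hne, norm_mul] at h1
    simp only [add_im, one_im, add_zero] at h1
    have h2 : 2 + |s.im| ≤ (2 + a) / a * ‖s‖ := by
      rw [div_mul_eq_mul_div, le_div_iff₀ ha]
      have := re_le_norm s
      have := abs_im_le_norm s
      nlinarith
    calc ‖Gamma s‖ * (2 + |s.im|) ^ (N + 1)
        = (2 + |s.im|) * (‖Gamma s‖ * (2 + |s.im|) ^ N) := by ring
      _ ≤ (2 + a) / a * ‖s‖ * (‖Gamma s‖ * (2 + |s.im|) ^ N) := by gcongr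
      _ = (2 + a) / a * (‖s‖ * ‖Gamma s‖ * (2 + |s.im|) ^ N) := by ring
      _ ≤ _ := by gcongr

/-- The function `Riesz_c(x) / x`, written as `∑ μ(n) n^{-c} exp(-n^{-c} x)`. -/
noncomputable def rieszQuot (c t : ℝ) : ℂ :=
  ∑' n : ℕ, ((ArithmeticFunction.moebius n : ℤ) : ℂ) * (((n : ℝ) ^ (-c) : ℝ) : ℂ) *
    (Real.exp (-((n : ℝ) ^ (-c)) * t) : ℂ)

lemma norm_moebius_le_one (n : ℕ) : ‖((ArithmeticFunction.moebius n : ℤ) : ℂ)‖ ≤ 1 := by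
  rw [Complex.norm_intCast]
  exact_mod_cast ArithmeticFunction.abs_moebius_le_one

lemma norm_rieszQuot_term_le (c t : ℝ) (n : ℕ) :
    ‖((ArithmeticFunction.moebius n : ℤ) : ℂ) * (((n : ℝ) ^ (-c) : ℝ) : ℂ) *
      (Real.exp (-((n : ℝ) ^ (-c)) * t) : ℂ)‖ ≤
      (n : ℝ) ^ (-c) * Real.exp (-((n : ℝ) ^ (-c)) * t) := by
  have hq : (0 : ℝ) ≤ (n : ℝ) ^ (-c) := by positivity
  rw [norm_mul, norm_mul, norm_real, norm_real, Real.norm_of_nonneg hq,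
    Real.norm_of_nonneg (Real.exp_nonneg _)]
  gcongr
  exact mul_le_of_le_one_left hq (norm_moebius_le_one n)

lemma norm_rieszQuot_term_le_rpow (c : ℝ) {t : ℝ} (ht : 0 ≤ t) (n : ℕ) :
    ‖((ArithmeticFunction.moebius n : ℤ) : ℂ) * (((n : ℝ) ^ (-c) : ℝ) : ℂ) *
      (Real.exp (-((n : ℝ) ^ (-c)) * t) : ℂ)‖ ≤ (n : ℝ) ^ (-c) := by
  have hq : (0 : ℝ) ≤ (n : ℝ) ^ (-c) := by positivity
  refine (norm_rieszQuot_term_le c t n).trans (mul_le_of_le_one_right hq ?_)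
  rw [Real.exp_le_one_iff, neg_mul]
  exact neg_nonpos.mpr (mul_nonneg hq ht)

lemma summable_nat_rpow_neg {c : ℝ} (hc : 1 < c) : Summable fun n : ℕ => (n : ℝ) ^ (-c) :=
  Real.summable_nat_rpow.mpr (by linarith)

lemma hasSum_rieszQuot {c : ℝ} (hc : 1 < c) {t : ℝ} (ht : 0 ≤ t) :
    HasSum (fun n : ℕ => ((ArithmeticFunction.moebius n : ℤ) : ℂ) * (((n : ℝ) ^ (-c) : ℝ) : ℂ) *
      (Real.exp (-((n : ℝ) ^ (-c)) * t) : ℂ)) (rieszQuot c t) :=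
  (Summable.of_norm_bounded (summable_nat_rpow_neg hc)
    (norm_rieszQuot_term_le_rpow c ht)).hasSum

lemma continuousOn_rieszQuot {c : ℝ} (hc : 1 < c) : ContinuousOn (rieszQuot c) (Ici 0) := by
  refine continuousOn_tsum (fun n => ?_) (summable_nat_rpow_neg hc)
    fun n t ht => norm_rieszQuot_term_le_rpow c ht n
  fun_prop

lemma Real.rpow_mul_exp_neg_le_one {a y : ℝ} (ha0 : 0 ≤ a) (ha1 : a ≤ 1) (hy : 0 ≤ y) :
    y ^ a * Real.exp (-y) ≤ 1 := by
  have h : y ^ a ≤ Real.exp y := by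
    rcases le_total y 1 with h1 | h1
    · exact (Real.rpow_le_one hy h1 ha0).trans (Real.one_le_exp hy)
    · calc y ^ a ≤ y ^ (1 : ℝ) := Real.rpow_le_rpow_of_exponent_le h1 ha1
        _ = y := Real.rpow_one y
        _ ≤ y + 1 := by linarith
        _ ≤ _ := Real.add_one_le_exp y
  rw [Real.exp_neg, mul_inv_le_iff₀ (Real.exp_pos y), one_mul]
  exact h

lemma isBigO_rieszQuot_atTop {c : ℝ} (hc : 1 < c) {a : ℝ} (ha0 : 0 ≤ a) (ha : a < 1 - 1 / c) :
    rieszQuot c =O[atTop] fun t : ℝ => t ^ (-a) := by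
  have hc0 : 0 < c := by linarith
  have hca : 1 < c * (1 - a) := by
    have : 1 / c < 1 - a := by linarith
    rwa [div_lt_iff₀' hc0] at this
  refine IsBigO.of_bound (∑' n : ℕ, (n : ℝ) ^ (-(c * (1 - a)))) ?_
  filter_upwards [eventually_gt_atTop 0] with t ht
  rw [Real.norm_of_nonneg (by positivity), ← tsum_mul_right]
  refine (hasSum_rieszQuot hc ht.le).norm_le_of_bounded
    ((summable_nat_rpow_neg hca).mul_right _).hasSum fun n => ?_
  rcases Nat.eq_zero_or_pos n with rfl | hn
  · have : (0 : ℝ) ≤ ((0 : ℕ) : ℝ) ^ (-(c * (1 - a))) * t ^ (-a) := by positivity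
    simpa using this
  refine (norm_rieszQuot_term_le c t n).trans ?_
  have hn0 : (0 : ℝ) < n := by exact_mod_cast hn
  set q : ℝ := (n : ℝ) ^ (-c) with hqdef
  have hq : 0 < q := by positivity
  have h1 : (q * t) ^ a * Real.exp (-(q * t)) ≤ 1 :=
    Real.rpow_mul_exp_neg_le_one ha0 (by have : 0 < 1 / c := by positivity
                                         linarith) (by positivity)
  have h2 : (n : ℝ) ^ (-(c * (1 - a))) = q * q ^ (-a) := by
    rw [hqdef, ← Real.rpow_mul hn0.le, ← Real.rpow_add hn0]
    ring_nf
  have h3 : q ^ (-a) * t ^ (-a) * (q * t) ^ a = 1 := by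
    rw [← Real.mul_rpow hq.le ht.le, ← Real.rpow_add (by positivity)]
    simp
  have h4 : Real.exp (-(q * t)) ≤ q ^ (-a) * t ^ (-a) := by
    calc Real.exp (-(q * t)) = q ^ (-a) * t ^ (-a) * ((q * t) ^ a * Real.exp (-(q * t))) := by
          rw [← mul_assoc, h3, one_mul]
      _ ≤ q ^ (-a) * t ^ (-a) * 1 := by gcongr
      _ = _ := mul_one _
  rw [h2, neg_mul, mul_assoc]
  gcongr

lemma isBigO_rieszQuot_nhds_zero {c : ℝ} (hc : 1 < c) :
    rieszQuot c =O[nhdsWithin 0 (Ioi 0)] fun t : ℝ => t ^ (-(0 : ℝ)) := by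
  refine IsBigO.of_bound (∑' n : ℕ, (n : ℝ) ^ (-c)) ?_
  filter_upwards [self_mem_nhdsWithin] with t ht
  rw [neg_zero, Real.rpow_zero, norm_one, mul_one]
  exact (hasSum_rieszQuot hc (le_of_lt ht)).norm_le_of_bounded
    (summable_nat_rpow_neg hc).hasSum (norm_rieszQuot_term_le_rpow c (le_of_lt ht))

lemma locallyIntegrableOn_rieszQuot {c : ℝ} (hc : 1 < c) :
    LocallyIntegrableOn (rieszQuot c) (Ioi 0) :=
  ((continuousOn_rieszQuot hc).mono Ioi_subset_Ici_self).locallyIntegrableOn measurableSet_Ioi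

lemma mellinConvergent_rieszQuot {c : ℝ} (hc : 1 < c) {s : ℂ} (hs0 : 0 < s.re)
    (hs1 : s.re < 1 - 1 / c) : MellinConvergent (rieszQuot c) s := by
  obtain ⟨a, ha1, ha2⟩ := exists_between hs1
  exact mellinConvergent_of_isBigO_rpow (locallyIntegrableOn_rieszQuot hc)
    (isBigO_rieszQuot_atTop hc (hs0.trans ha1).le ha2) ha1 (isBigO_rieszQuot_nhds_zero hc) hs0

lemma mellin_rieszQuot {c : ℝ} (hc : 1 < c) {s : ℂ} (hs0 : 0 < s.re) (hs1 : s.re < 1 - 1 / c) :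
    mellin (rieszQuot c) s = Gamma s * (riemannZeta (c * (1 - s)))⁻¹ := by
  have hc0 : 0 < c := by linarith
  have hca : 1 < c * (1 - s.re) := by
    have : 1 / c < 1 - s.re := by linarith
    rwa [div_lt_iff₀' hc0] at this
  have hre : 1 < ((c : ℂ) * (1 - s)).re := by simpa using hca
  have hM := hasSum_mellin
    (a := fun n : ℕ => ((ArithmeticFunction.moebius n : ℤ) : ℂ) * (((n : ℝ) ^ (-c) : ℝ) : ℂ))
    (p := fun n : ℕ => (n : ℝ) ^ (-c)) (F := rieszQuot c) (s := s) (fun n => by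
      rcases Nat.eq_zero_or_pos n with rfl | hn
      · simp
      · right
        have hn0 : (0 : ℝ) < n := by exact_mod_cast hn
        positivity) hs0 (fun t ht => hasSum_rieszQuot hc (le_of_lt ht)) (by
      refine Summable.of_nonneg_of_le (fun n => by positivity) (fun n => ?_)
        (summable_nat_rpow_neg hca)
      rcases Nat.eq_zero_or_pos n with rfl | hn
      · have : (0 : ℝ) ≤ ((0 : ℕ) : ℝ) ^ (-(c * (1 - s.re))) := by positivity
        simpa using this
      have hn0 : (0 : ℝ) < n := by exact_mod_cast hn
      have hq : (0 : ℝ) < (n : ℝ) ^ (-c) := by positivity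
      have h2 : (n : ℝ) ^ (-(c * (1 - s.re))) = (n : ℝ) ^ (-c) / ((n : ℝ) ^ (-c)) ^ s.re := by
        rw [← Real.rpow_mul hn0.le, ← Real.rpow_sub hn0]
        ring_nf
      rw [h2, norm_mul, norm_real, Real.norm_of_nonneg hq.le]
      gcongr
      exact mul_le_of_le_one_left hq.le (norm_moebius_le_one n))
  refine hM.unique (((inv_riemannZeta_eq_tsum hre).mul_left (Gamma s)).congr_fun fun n => ?_)
  rcases Nat.eq_zero_or_pos n with rfl | hn
  · simp
  have hn0 : (0 : ℝ) < n := by exact_mod_cast hn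
  have hn1 : (n : ℂ) ≠ 0 := by exact_mod_cast hn.ne'
  have h1 : ((((n : ℝ) ^ (-c) : ℝ) : ℂ)) ^ s = (n : ℂ) ^ (-(c : ℂ) * s) := by
    rw [cpow_def_of_ne_zero (by exact_mod_cast (Real.rpow_pos_of_pos hn0 _).ne'),
      cpow_def_of_ne_zero hn1, ← ofReal_log (by positivity), Real.log_rpow hn0, ← natCast_log]
    push_cast
    ring_nf
  have h2 : (((n : ℝ) ^ (-c) : ℝ) : ℂ) = (n : ℂ) ^ (-(c : ℂ)) := by
    rw [ofReal_cpow hn0.le]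
    simp
  have h3 : (n : ℂ) ^ (-(c * (1 - s))) = (n : ℂ) ^ (-(c : ℂ)) / (n : ℂ) ^ (-(c : ℂ) * s) := by
    rw [← cpow_sub _ _ hn1]
    ring_nf
  rw [h1, h2, h3]
  ring

lemma tsum_riesz_eq {c : ℝ} (hc : 1 < c) {x : ℝ} (hx : 0 < x) :
    ∑' k : ℕ, (-1 : ℂ) ^ k * (x : ℂ) ^ (k + 1) /
      ((Nat.factorial k : ℂ) * riemannZeta ((c * (k + 1) : ℝ) : ℂ)) = x * rieszQuot c x := by
  have hc0 : 0 < c := by linarith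
  set g : ℕ → ℕ → ℂ := fun n k => ((ArithmeticFunction.moebius n : ℤ) : ℂ) *
    (((n : ℝ) ^ (-c) : ℝ) : ℂ) ^ (k + 1) * ((-1 : ℂ) ^ k * (x : ℂ) ^ (k + 1) / (Nat.factorial k : ℂ))
    with hg
  have hq1 : ∀ n : ℕ, (n : ℝ) ^ (-c) ≤ 1 := fun n => by
    rcases Nat.eq_zero_or_pos n with rfl | hn
    · simp [Real.zero_rpow (neg_ne_zero.mpr hc0.ne')]
    · exact Real.rpow_le_one_of_one_le_of_nonpos (by exact_mod_cast hn) (by linarith)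
  have hexp : Summable fun k : ℕ => x ^ (k + 1) / (Nat.factorial k : ℝ) := by
    refine ((Real.summable_pow_div_factorial x).mul_left x).congr fun k => ?_
    ring
  have hsum : Summable (Function.uncurry g) := by
    refine Summable.of_norm_bounded ((summable_nat_rpow_neg hc).mul_of_nonneg hexp
      (fun n => by positivity) (fun k => by positivity)) fun ⟨n, k⟩ => ?_
    have hq : (0 : ℝ) ≤ (n : ℝ) ^ (-c) := by positivity
    simp only [Function.uncurry, hg, norm_mul, norm_div, norm_pow, norm_real, norm_neg, norm_one,
      one_pow, one_mul, Real.norm_of_nonneg hq, Real.norm_of_nonneg hx.le, norm_natCast]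
    gcongr
    calc _ ≤ 1 * ((n : ℝ) ^ (-c)) ^ (k + 1) := by gcongr; exact norm_moebius_le_one n
      _ = (n : ℝ) ^ (-c) * ((n : ℝ) ^ (-c)) ^ k := by ring
      _ ≤ (n : ℝ) ^ (-c) * 1 := by gcongr; exact pow_le_one₀ hq (hq1 n)
      _ = _ := mul_one _
  have hn : ∀ n, ∑' k, g n k = x * (((ArithmeticFunction.moebius n : ℤ) : ℂ) *
      (((n : ℝ) ^ (-c) : ℝ) : ℂ) * (Real.exp (-((n : ℝ) ^ (-c)) * x) : ℂ)) := fun n => by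
    have h := (NormedSpace.expSeries_div_hasSum_exp
      (((-((n : ℝ) ^ (-c)) * x : ℝ) : ℂ))).mul_left (x * (((ArithmeticFunction.moebius n : ℤ) : ℂ) *
      (((n : ℝ) ^ (-c) : ℝ) : ℂ)))
    rw [← exp_eq_exp_ℂ, ← ofReal_exp, mul_assoc] at h
    refine HasSum.tsum_eq (h.congr_fun fun k => ?_)
    simp only [hg, ofReal_mul, ofReal_neg, mul_pow, neg_pow (((n : ℝ) ^ (-c) : ℝ) : ℂ)]
    ring
  have hk : ∀ k : ℕ, ∑' n, g n k = (-1 : ℂ) ^ k * (x : ℂ) ^ (k + 1) /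
      ((Nat.factorial k : ℂ) * riemannZeta ((c * (k + 1) : ℝ) : ℂ)) := fun k => by
    have hre : 1 < (((c * (k + 1) : ℝ) : ℂ)).re := by
      rw [ofReal_re]
      have : (0 : ℝ) ≤ k := k.cast_nonneg
      nlinarith
    have h := (inv_riemannZeta_eq_tsum hre).mul_right
      ((-1 : ℂ) ^ k * (x : ℂ) ^ (k + 1) / (Nat.factorial k : ℂ))
    rw [show (-1 : ℂ) ^ k * (x : ℂ) ^ (k + 1) /
      ((Nat.factorial k : ℂ) * riemannZeta ((c * (k + 1) : ℝ) : ℂ)) =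
      (riemannZeta ((c * (k + 1) : ℝ) : ℂ))⁻¹ *
      ((-1 : ℂ) ^ k * (x : ℂ) ^ (k + 1) / (Nat.factorial k : ℂ)) by
        rw [div_mul_eq_div_div, div_eq_mul_inv, mul_comm]]
    refine HasSum.tsum_eq (h.congr_fun fun n => ?_)
    rcases Nat.eq_zero_or_pos n with rfl | hn
    · simp [hg]
    have hn0 : (0 : ℝ) < n := by exact_mod_cast hn
    have e : (((n : ℝ) ^ (-c) : ℝ) : ℂ) ^ (k + 1) = (n : ℂ) ^ (-((c * (k + 1) : ℝ) : ℂ)) := by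
      rw [← ofReal_pow, ← Real.rpow_natCast, ← Real.rpow_mul hn0.le, ofReal_cpow hn0.le]
      push_cast
      ring_nf
    simp only [hg, e]
  simp_rw [← hk]
  rw [Summable.tsum_comm hsum]
  simp_rw [hn]
  rw [tsum_mul_left, rieszQuot]

lemma norm_le_mul_inv_one_add_sq {f : ℂ → ℂ} {C : ℝ} {s : ℂ}
    (hs : ‖f s‖ * (2 + |s.im|) ^ 2 ≤ C) : ‖f s‖ ≤ C * (1 + s.im ^ 2)⁻¹ := by
  rw [← div_eq_mul_inv, le_div_iff₀ (by positivity)]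
  refine le_trans ?_ hs
  gcongr
  nlinarith [sq_abs s.im, abs_nonneg s.im]

lemma integrable_vertical_of_bound {f : ℂ → ℂ} {C σ : ℝ}
    (hd : ∀ s : ℂ, s.re = σ → ContinuousAt f s)
    (hC : ∀ s : ℂ, s.re = σ → ‖f s‖ * (2 + |s.im|) ^ 2 ≤ C) :
    Integrable fun y : ℝ => f (σ + y * I) := by
  refine (integrable_inv_one_add_sq.const_mul C).mono' ?_ (.of_forall fun y => ?_)
  · refine Continuous.aestronglyMeasurable ?_
    refine continuous_iff_continuousAt.mpr fun y => ?_
    exact ContinuousAt.comp (f := fun y : ℝ => (σ : ℂ) + y * I) (hd _ (by simp)) (by fun_prop)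
  · simpa using norm_le_mul_inv_one_add_sq (hC (σ + y * I) (by simp))

/-- Moving a vertical line of integration across a strip of holomorphy. -/
lemma integral_vertical_eq_of_bound {f : ℂ → ℂ} {a b C : ℝ} (hab : a ≤ b)
    (hd : ∀ s : ℂ, a ≤ s.re → s.re ≤ b → DifferentiableAt ℂ f s)
    (hC : ∀ s : ℂ, a ≤ s.re → s.re ≤ b → ‖f s‖ * (2 + |s.im|) ^ 2 ≤ C) :
    ∫ y : ℝ, f (a + y * I) = ∫ y : ℝ, f (b + y * I) := by
  have hline : ∀ σ : ℝ, a ≤ σ → σ ≤ b → Tendsto (fun T : ℝ => ∫ y in (-T)..T, f (σ + y * I)) atTop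
      (nhds (∫ y : ℝ, f (σ + y * I))) := fun σ h1 h2 =>
    intervalIntegral_tendsto_integral (integrable_vertical_of_bound
      (fun s hs => (hd s (by linarith) (by linarith)).continuousAt)
      (fun s hs => hC s (by linarith) (by linarith))) tendsto_neg_atTop_atBot tendsto_id
  have hdecay : Tendsto (fun T : ℝ => C * (1 + T ^ 2)⁻¹ * |b - a|) atTop (nhds 0) := by
    have h1 : Tendsto (fun T : ℝ => 1 + T ^ 2) atTop atTop :=
      tendsto_atTop_add_const_left _ _ (tendsto_pow_atTop two_ne_zero)
    simpa using (h1.inv_tendsto_atTop.const_mul C).mul_const |b - a|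
  have hhor : ∀ t : ℝ, ‖∫ x in a..b, f (x + t * I)‖ ≤ C * (1 + t ^ 2)⁻¹ * |b - a| := fun t => by
    refine intervalIntegral.norm_integral_le_of_norm_le_const fun x hx => ?_
    rw [uIoc_of_le hab] at hx
    simpa using norm_le_mul_inv_one_add_sq
      (hC (x + t * I) (by simpa using hx.1.le) (by simpa using hx.2))
  have htop : Tendsto (fun T : ℝ => ∫ x in a..b, f (x + T * I)) atTop (nhds 0) :=
    squeeze_zero_norm hhor hdecay
  have hbot : Tendsto (fun T : ℝ => ∫ x in a..b, f (x + (-T : ℝ) * I)) atTop (nhds 0) :=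
    squeeze_zero_norm (fun T => by simpa using hhor (-T)) hdecay
  have hrect : ∀ T : ℝ, (∫ x in a..b, f (x + (-T : ℝ) * I)) - (∫ x in a..b, f (x + T * I)) +
      I • (∫ y in (-T)..T, f (b + y * I)) - I • (∫ y in (-T)..T, f (a + y * I)) = 0 := fun T => by
    have h := integral_boundary_rect_eq_zero_of_differentiableOn f ⟨a, -T⟩ ⟨b, T⟩ (fun s hs => by
      have hs1 : s.re ∈ uIcc a b := hs.1
      rw [uIcc_of_le hab] at hs1
      exact (hd s hs1.1 hs1.2).differentiableWithinAt)
    simpa using h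
  have hlim := ((hbot.sub htop).add ((hline b hab le_rfl).const_smul I)).sub
    ((hline a le_rfl hab).const_smul I)
  simp only [hrect] at hlim
  have h0 := tendsto_nhds_unique hlim tendsto_const_nhds
  rw [sub_zero, zero_add, ← smul_sub, smul_eq_zero, or_iff_right I_ne_zero, sub_eq_zero] at h0
  exact h0.symm

/-- The function extending the Mellin transform of `rieszQuot c`. -/
noncomputable def rieszMellin (c : ℝ) (s : ℂ) : ℂ :=
  Gamma s * ((c * (1 - s) - 1) * (zetaMulSubOne (c * (1 - s)))⁻¹)

lemma mellin_rieszQuot_eq_rieszMellin {c : ℝ} (hc : 1 < c) {s : ℂ} (hs0 : 0 < s.re)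
    (hs1 : s.re < 1 - 1 / c) : mellin (rieszQuot c) s = rieszMellin c s := by
  have hc0 : 0 < c := by linarith
  have hre : 1 < ((c : ℂ) * (1 - s)).re := by
    have : 1 / c < 1 - s.re := by linarith
    rw [div_lt_iff₀' hc0] at this
    simpa using this
  have hne : (c : ℂ) * (1 - s) - 1 ≠ 0 := fun h => by
    rw [sub_eq_zero.mp h] at hre
    simp at hre
  rw [mellin_rieszQuot hc hs0 hs1, rieszMellin, zetaMulSubOne_of_one_lt_re hre, mul_inv,
    mul_inv_cancel_left₀ hne]

lemma differentiableAt_rieszMellin {c : ℝ} {s : ℂ} (hs0 : 0 < s.re)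
    (hre : 0 < ((c : ℂ) * (1 - s)).re) (hne : zetaMulSubOne (c * (1 - s)) ≠ 0) :
    DifferentiableAt ℂ (rieszMellin c) s := by
  have hG : DifferentiableAt ℂ Gamma s := differentiableAt_Gamma s fun m h => by
    rw [h, neg_re, natCast_re] at hs0
    have : (0 : ℝ) ≤ m := m.cast_nonneg
    linarith
  have hZ : DifferentiableAt ℂ (fun s => zetaMulSubOne (c * (1 - s))) s := by
    refine DifferentiableAt.comp (g := zetaMulSubOne) s ?_ (by fun_prop)
    exact differentiableOn_zetaMulSubOne.differentiableAt
      ((isOpen_lt continuous_const continuous_re).mem_nhds hre)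
  exact hG.mul (DifferentiableAt.mul (by fun_prop) (hZ.inv hne))

lemma exists_norm_rieszMellin_mul_le (h : ∀ s : ℂ, 1 / 2 < s.re → zetaMulSubOne s ≠ 0)
    {c : ℝ} (hc : 1 < c) {a b η : ℝ} (ha : 0 < a) (hη : 0 < η) (hca : c * (1 - a) ≤ 2)
    (hcb : 1 / 2 + η ≤ c * (1 - b)) :
    ∃ C, ∀ s : ℂ, a ≤ s.re → s.re ≤ b → ‖rieszMellin c s‖ * (2 + |s.im|) ^ 2 ≤ C := by
  have hc0 : 0 < c := by linarith
  obtain ⟨K, N, hK, hZ⟩ := exists_norm_inv_zetaMulSubOne_le h hη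
  obtain ⟨D, hD⟩ := exists_norm_Gamma_mul_le (N + 3) (b := b) ha
  refine ⟨D * (c * 2 * (K * c ^ N)), fun s hs1 hs2 => ?_⟩
  set u : ℂ := c * (1 - s) with hu
  have hure : u.re = c * (1 - s.re) := by simp [hu]
  have huim : |u.im| = c * |s.im| := by simp [hu, abs_mul, abs_of_pos hc0]
  have hu1 : 1 / 2 + η ≤ u.re := by
    rw [hure]
    exact hcb.trans (by gcongr)
  have hu2 : u.re ≤ 2 := by
    rw [hure]
    exact le_trans (by gcongr) hca
  have hs : 0 ≤ |s.im| := abs_nonneg _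
  have h1 : 2 + |u.im| ≤ c * (2 + |s.im|) := by
    rw [huim]
    linarith
  have h2 : ‖u - 1‖ ≤ c * 2 * (2 + |s.im|) := by
    refine (norm_le_abs_re_add_abs_im _).trans ?_
    have : |(u - 1).re| ≤ 1 := by
      rw [sub_re, one_re, abs_le]
      constructor <;> linarith
    have h3 : |(u - 1).im| = |u.im| := by simp
    rw [h3]
    nlinarith
  have h3 : ‖(zetaMulSubOne u)⁻¹‖ ≤ K * c ^ N * (2 + |s.im|) ^ N := by
    refine (hZ u hu1 hu2).trans ?_
    rw [mul_assoc, ← mul_pow]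
    gcongr
  calc ‖rieszMellin c s‖ * (2 + |s.im|) ^ 2
      = ‖Gamma s‖ * (‖u - 1‖ * ‖(zetaMulSubOne u)⁻¹‖) * (2 + |s.im|) ^ 2 := by
        rw [rieszMellin, norm_mul, norm_mul]
    _ ≤ ‖Gamma s‖ * (c * 2 * (2 + |s.im|) * (K * c ^ N * (2 + |s.im|) ^ N)) *
        (2 + |s.im|) ^ 2 := by gcongr
    _ = ‖Gamma s‖ * (2 + |s.im|) ^ (N + 3) * (c * 2 * (K * c ^ N)) := by ring
    _ ≤ _ := by
        gcongr
        exact hD s hs1 hs2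

lemma isBigO_rieszQuot_of_ne_zero (h : ∀ s : ℂ, 1 / 2 < s.re → zetaMulSubOne s ≠ 0)
    {c : ℝ} (hc : 1 < c) {b : ℝ} (hb0 : 1 - 1 / c ≤ b) (hb : b < 1 - 1 / (2 * c)) :
    rieszQuot c =O[atTop] fun x : ℝ => x ^ (-b) := by
  have hc0 : 0 < c := by linarith
  obtain ⟨α, hα1, hα2⟩ := exists_between (lt_min hc one_lt_two)
  set a : ℝ := 1 - α / c with ha_def
  have hca : c * (1 - a) = α := by rw [ha_def]; field_simp; ring
  have ha : 0 < a := by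
    rw [ha_def, sub_pos, div_lt_one hc0]
    exact hα2.trans_le (min_le_left _ _)
  have ha1 : a < 1 - 1 / c := by
    rw [ha_def]
    gcongr
  have hab : a ≤ b := ha1.le.trans hb0
  have hcb : 0 < c * (1 - b) - 1 / 2 := by
    have h1 : 1 / (2 * c) < 1 - b := by linarith
    rw [div_lt_iff₀ (by positivity)] at h1
    linarith
  obtain ⟨C, hC⟩ := exists_norm_rieszMellin_mul_le h hc (a := a) (b := b) ha hcb
    (hca.trans_le (hα2.le.trans (min_le_right _ _))) (by linarith)
  have hre : ∀ s : ℂ, s.re ≤ b → 1 / 2 < ((c : ℂ) * (1 - s)).re := fun s hs => by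
    have : c * (1 - b) ≤ c * (1 - s.re) := by gcongr
    have e : ((c : ℂ) * (1 - s)).re = c * (1 - s.re) := by simp
    linarith
  have hd : ∀ s : ℂ, a ≤ s.re → s.re ≤ b → DifferentiableAt ℂ (rieszMellin c) s :=
    fun s hs1 hs2 => differentiableAt_rieszMellin (by linarith)
      (by linarith [hre s hs2]) (h _ (hre s hs2))
  have hmel : ∀ y : ℝ, mellin (rieszQuot c) (a + y * I) = rieszMellin c (a + y * I) := fun y =>
    mellin_rieszQuot_eq_rieszMellin hc (by simpa using ha) (by simpa using ha1)
  have hvert : VerticalIntegrable (mellin (rieszQuot c)) a := by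
    simp only [VerticalIntegrable, hmel]
    exact integrable_vertical_of_bound
      (fun s hs => (hd s hs.ge (hs.le.trans hab)).continuousAt)
      (fun s hs => hC s hs.ge (hs.le.trans hab))
  refine IsBigO.of_bound (1 / (2 * Real.pi) * ∫ y : ℝ, C * (1 + y ^ 2)⁻¹) ?_
  filter_upwards [eventually_ge_atTop 1] with x hx
  have hx0 : 0 < x := by linarith
  have hxc : (x : ℂ) ≠ 0 := by exact_mod_cast hx0.ne'
  have hnorm : ∀ s : ℂ, ‖(x : ℂ) ^ (-s)‖ = x ^ (-s.re) := fun s => by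
    rw [norm_cpow_eq_rpow_re_of_pos hx0, neg_re]
  have hinv := mellinInv_mellin_eq a (rieszQuot c) hx0
    (mellinConvergent_rieszQuot hc (by simpa using ha) (by simpa using ha1)) hvert
    ((continuousOn_rieszQuot hc).continuousAt (Ici_mem_nhds hx0))
  have hshift : ∫ y : ℝ, (x : ℂ) ^ (-((a : ℂ) + y * I)) * rieszMellin c (a + y * I) =
      ∫ y : ℝ, (x : ℂ) ^ (-((b : ℂ) + y * I)) * rieszMellin c (b + y * I) := by
    refine integral_vertical_eq_of_bound (f := fun s => (x : ℂ) ^ (-s) * rieszMellin c s)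
      (C := C) hab (fun s hs1 hs2 => ?_) fun s hs1 hs2 => ?_
    · exact ((differentiableAt_id.neg).const_cpow (Or.inl hxc)).mul (hd s hs1 hs2)
    · refine le_trans ?_ (hC s hs1 hs2)
      rw [norm_mul, hnorm]
      gcongr
      exact mul_le_of_le_one_left (norm_nonneg _)
        (Real.rpow_le_one_of_one_le_of_nonpos hx (by linarith))
  rw [← hinv, mellinInv]
  simp only [hmel, smul_eq_mul]
  rw [hshift, norm_smul, Real.norm_of_nonneg (by positivity),
    Real.norm_of_nonneg (by positivity), mul_assoc, ← integral_mul_const]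
  gcongr
  refine norm_integral_le_of_norm_le ((integrable_inv_one_add_sq.const_mul C).mul_const _)
    (.of_forall fun y => ?_)
  rw [norm_mul, hnorm, mul_comm]
  have h1 := norm_le_mul_inv_one_add_sq (hC (b + y * I) (by simpa using hab) (by simp))
  simp only [add_im, ofReal_im, mul_im, ofReal_re, I_im, mul_one, I_re, mul_zero, add_zero,
    zero_add] at h1
  have h2 : ((b : ℂ) + y * I).re = b := by simp
  rw [h2]
  gcongr

lemma zetaMulSubOne_ne_zero_of_isBigO {c : ℝ} (hc : 1 < c)
    (h : ∀ b < 1 - 1 / (2 * c), rieszQuot c =O[atTop] fun x : ℝ => x ^ (-b)) {u : ℂ}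
    (hu : 1 / 2 < u.re) : zetaMulSubOne u ≠ 0 := by
  have hc0 : 0 < c := by linarith
  have hcc : (c : ℂ) ≠ 0 := by exact_mod_cast hc0.ne'
  rcases le_or_gt c u.re with huc | huc
  · have h1 : 1 < u.re := by linarith
    rw [zetaMulSubOne_of_one_lt_re h1]
    refine mul_ne_zero (fun h0 => ?_) (riemannZeta_ne_zero_of_one_le_re h1.le)
    rw [sub_eq_zero.mp h0] at h1
    simp at h1
  intro hu0
  set U : Set ℂ := {s | 0 < s.re} ∩ {s | s.re < 1 - 1 / (2 * c)} with hU
  have hUopen : IsOpen U := (isOpen_lt continuous_const continuous_re).inter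
    (isOpen_lt continuous_re continuous_const)
  have hUconv : Convex ℝ U := (convex_halfSpace_re_gt 0).inter (convex_halfSpace_re_lt _)
  have hUre : ∀ s ∈ U, 0 < ((c : ℂ) * (1 - s)).re := fun s hs => by
    have h1 : s.re < 1 - 1 / (2 * c) := hs.2
    have h2 : 0 < 1 / (2 * c) := by positivity
    have h3 : 0 < c * (1 - s.re) := mul_pos hc0 (by linarith)
    simpa using h3
  have hM : DifferentiableOn ℂ (fun s => mellin (rieszQuot c) s * zetaMulSubOne (c * (1 - s))) U :=
    fun s hs => by
      obtain ⟨b, hb1, hb2⟩ := exists_between (show s.re < 1 - 1 / (2 * c) from hs.2)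
      have h1 := mellin_differentiableAt_of_isBigO_rpow (locallyIntegrableOn_rieszQuot hc) (h b hb2)
        hb1 (isBigO_rieszQuot_nhds_zero hc) hs.1
      have h2 : DifferentiableAt ℂ (fun s => zetaMulSubOne (c * (1 - s))) s := by
        refine DifferentiableAt.comp (g := zetaMulSubOne) s ?_ (by fun_prop)
        exact differentiableOn_zetaMulSubOne.differentiableAt
          ((isOpen_lt continuous_const continuous_re).mem_nhds (hUre s hs))
      exact (h1.mul h2).differentiableWithinAt
  have hG : DifferentiableOn ℂ (fun s => Gamma s * (c * (1 - s) - 1)) U := fun s hs => by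
    have h1 : DifferentiableAt ℂ Gamma s := differentiableAt_Gamma s fun m hm => by
      have h0 : 0 < s.re := hs.1
      rw [hm, neg_re, natCast_re] at h0
      have : (0 : ℝ) ≤ m := m.cast_nonneg
      linarith
    exact (h1.mul (by fun_prop)).differentiableWithinAt
  have hc1 : 0 < 1 - 1 / c := by
    rw [sub_pos, div_lt_one hc0]
    exact hc
  obtain ⟨σ, hσ0, hσ1⟩ := exists_between hc1
  have hcc2 : 1 / (2 * c) ≤ 1 / c := by
    gcongr
    linarith
  have heq := (hM.analyticOnNhd hUopen).eqOn_of_preconnected_of_eventuallyEq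
    (hG.analyticOnNhd hUopen) hUconv.isPreconnected (z₀ := σ)
    ⟨by simpa using hσ0, by simp only [mem_ofPred_eq, ofReal_re]; linarith⟩ (by
      have h1 : {s : ℂ | 0 < s.re} ∩ {s | s.re < 1 - 1 / c} ∈ nhds (σ : ℂ) :=
        ((isOpen_lt continuous_const continuous_re).inter
          (isOpen_lt continuous_re continuous_const)).mem_nhds ⟨by simpa using hσ0,
            by simpa using hσ1⟩
      filter_upwards [h1] with s hs
      have hre : 1 < ((c : ℂ) * (1 - s)).re := by
        have h2 : s.re < 1 - 1 / c := hs.2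
        have h3 : 1 / c < 1 - s.re := by linarith
        rw [div_lt_iff₀' hc0] at h3
        simpa using h3
      rw [mellin_rieszQuot hc hs.1 hs.2, zetaMulSubOne_of_one_lt_re hre]
      field_simp [riemannZeta_ne_zero_of_one_le_re hre.le])
  have hsre : (1 - u / (c : ℂ)).re = 1 - u.re / c := by simp
  have hsU : 1 - u / (c : ℂ) ∈ U := by
    refine ⟨?_, ?_⟩
    · rw [mem_ofPred_eq, hsre, sub_pos, div_lt_one hc0]
      exact huc
    · rw [mem_ofPred_eq, hsre]
      gcongr 1 - ?_
      rw [← div_div]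
      gcongr
  have hcs : (c : ℂ) * (1 - (1 - u / c)) = u := by
    field_simp
    ring
  have h1 := heq hsU
  simp only [hcs, hu0, mul_zero] at h1
  rcases mul_eq_zero.mp h1.symm with h2 | h2
  · exact Gamma_ne_zero_of_re_pos hsU.1 h2
  · rw [sub_eq_zero.mp h2] at hu0
    simp at hu0

end Riesz

/-- Let `c > 1` and let
`Riesz_c(x) = Σ_{k≥1} (-1)^{k+1} x^k / ((k-1)! ζ(ck))` (reindexed by `k ↦ k + 1`).  Then the
Riemann hypothesis holds iff for every `ε > 0` we have `Riesz_c(x) = O(x^{1/(2c)+ε})` as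
`x → ∞` along the positive reals. -/
theorem riemannHypothesis_iff_rieszC_isBigO (c : ℝ) (hc : 1 < c) :
    RiemannHypothesis ↔
      ∀ ε : ℝ, 0 < ε →
        (fun x : ℝ => ∑' k : ℕ, (-1 : ℂ) ^ k * (x : ℂ) ^ (k + 1) /
            ((Nat.factorial k : ℂ) * riemannZeta ((c * (k + 1) : ℝ) : ℂ)))
          =O[atTop] fun x : ℝ => x ^ (1 / (2 * c) + ε) := by
  have hc0 : 0 < c := by linarith
  have hcc : 1 / c = 1 / (2 * c) + 1 / (2 * c) := by
    field_simp
    norm_num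
  have hpos : 0 < 1 / (2 * c) := by positivity
  have hriesz : (fun x : ℝ => ∑' k : ℕ, (-1 : ℂ) ^ k * (x : ℂ) ^ (k + 1) /
      ((Nat.factorial k : ℂ) * riemannZeta ((c * (k + 1) : ℝ) : ℂ))) =ᶠ[atTop]
      fun x : ℝ => (x : ℂ) * rieszQuot c x := by
    filter_upwards [eventually_gt_atTop 0] with x hx using tsum_riesz_eq hc hx
  have hcast : (fun x : ℝ => (x : ℂ)) =Θ[atTop] fun x : ℝ => x :=
    IsTheta.of_norm_eventuallyEq_norm (.of_forall fun x => by simp)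
  rw [riemannHypothesis_iff_zetaMulSubOne_ne_zero]
  constructor
  · intro h ε hε
    set δ := min ε (1 / (2 * c)) with hδ
    have hδ0 : 0 < δ := lt_min hε hpos
    have hδ1 : δ ≤ 1 / (2 * c) := min_le_right _ _
    refine (hcast.1.mul (isBigO_rieszQuot_of_ne_zero h hc (b := 1 - 1 / (2 * c) - δ)
      (by linarith) (by linarith))).congr' hriesz.symm .rfl |>.trans ?_
    refine IsBigO.of_bound 1 ?_
    filter_upwards [eventually_ge_atTop 1] with x hx
    have hx0 : 0 < x := by linarith
    rw [one_mul, Real.norm_of_nonneg (by positivity), Real.norm_of_nonneg (by positivity)]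
    calc x * x ^ (-(1 - 1 / (2 * c) - δ)) = x ^ (1 + -(1 - 1 / (2 * c) - δ)) := by
          rw [Real.rpow_add hx0, Real.rpow_one]
      _ ≤ x ^ (1 / (2 * c) + ε) := by
          refine Real.rpow_le_rpow_of_exponent_le hx ?_
          linarith [min_le_left ε (1 / (2 * c))]
  · intro h u hu
    refine zetaMulSubOne_ne_zero_of_isBigO hc (fun b hb => ?_) hu
    have h1 := (h (1 - 1 / (2 * c) - b) (by linarith)).congr' hriesz .rfl
    refine (hcast.inv.1.mul h1).congr' ?_ ?_
    · filter_upwards [eventually_gt_atTop 0] with x hx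
      rw [inv_mul_cancel_left₀ (by exact_mod_cast hx.ne')]
    · filter_upwards [eventually_gt_atTop 0] with x hx
      rw [← Real.rpow_neg_one, ← Real.rpow_add hx]
      ring_nf
end
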